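/- arXiv:1609.05996 — 3 statements merged into one kernel-verified Lean document; each statement's English description precedes it below -/
import Mathlib

section
/- For every real a with a > 1, the set of equilibria of the system dx/dt = y² − ay − x, dy/dt = x² − ax − y is exactly the four points {(0,0), (x₂,y₂), (y₂,x₂), (a+1,a+1)}, where x₂ = (a−1)/2 + (1/2)·√((a−1)(a+3)) and y₂ = (a−1)/2 − (1/2)·√((a−1)(a+3)). -/
/-- For every real `a > 1`, the set of equilibria of the system
`dx/dt = y² − ay − x`, `dy/dt = x² − ax − y` is exactly the four points
`(0,0)`, `(x₂,y₂)`, `(y₂,x₂)`, `(a+1,a+1)` where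
`x₂ = (a−1)/2 + (1/2)√((a−1)(a+3))` and `y₂ = (a−1)/2 − (1/2)√((a−1)(a+3))`. -/
theorem equilibria_set_for_a_gt_one (a : ℝ) (ha : 1 < a)
    (x₂ y₂ : ℝ)
    (hx₂ : x₂ = (a - 1)/2 + (1/2) * Real.sqrt ((a - 1)*(a + 3)))
    (hy₂ : y₂ = (a - 1)/2 - (1/2) * Real.sqrt ((a - 1)*(a + 3))) :
    {p : ℝ × ℝ | p.2^2 - a*p.2 - p.1 = 0 ∧ p.1^2 - a*p.1 - p.2 = 0}
      = {(0, 0), (x₂, y₂), (y₂, x₂), (a + 1, a + 1)} := by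
  have hsum : x₂ + y₂ = a - 1 := by rw [hx₂, hy₂]; ring
  have hprod : x₂ * y₂ = -(a - 1) := by
    have hsq := Real.sq_sqrt (show 0 ≤ (a - 1) * (a + 3) by nlinarith)
    rw [hx₂, hy₂]
    linear_combination (-1 / 4) * hsq
  clear hx₂ hy₂
  ext ⟨x, y⟩
  simp only [Set.mem_ofPred_eq, Set.mem_insert_iff, Set.mem_singleton_iff, Prod.mk.injEq]
  constructor
  · rintro ⟨h₁, h₂⟩
    have hfactor : (y - x) * (x + y - (a - 1)) = 0 := by linear_combination h₁ - h₂
    rcases mul_eq_zero.mp hfactor with hdiag | hoff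
    · obtain rfl : y = x := sub_eq_zero.mp hdiag
      have hroots : y * (y - (a + 1)) = 0 := by linear_combination h₁
      rcases mul_eq_zero.mp hroots with h | h
      · exact Or.inl ⟨h, h⟩
      · exact Or.inr (Or.inr (Or.inr ⟨sub_eq_zero.mp h, sub_eq_zero.mp h⟩))
    · have hroots : (x - x₂) * (x - y₂) = 0 := by
        linear_combination h₂ + hoff - x * hsum + hprod
      rcases mul_eq_zero.mp hroots with h | h
      · exact Or.inr (Or.inl ⟨by linarith, by linarith⟩)
      · exact Or.inr (Or.inr (Or.inl ⟨by linarith, by linarith⟩))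
  · obtain rfl : a = x₂ + y₂ + 1 := by linarith
    rintro (⟨rfl, rfl⟩ | ⟨rfl, rfl⟩ | ⟨rfl, rfl⟩ | ⟨rfl, rfl⟩)
    · constructor <;> ring
    · constructor <;> linear_combination -hprod
    · constructor <;> linear_combination -hprod
    · constructor <;> ring
end

section
/- For every real a > 1, at the equilibrium (x₂, y₂) with x₂ = (a−1)/2 + (1/2)·√((a−1)(a+3)) and y₂ = (a−1)/2 − (1/2)·√((a−1)(a+3)), the Jacobian matrix [[−1, 2y₂ − a], [2x₂ − a, −1]] of the system dx/dt = y² − ay − x, dy/dt = x² − ax − y has trace −2 and determinant (a−1)(a+3) > 0; consequently every eigenvalue (real or complex) of this Jacobian has strictly negative real part, so the equilibrium (x₂, y₂) is linearly stable. -/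
/-- Every complex eigenvalue of a real `2 × 2` matrix with negative trace and positive determinant
has negative real part. -/
theorem Matrix.re_neg_of_mem_spectrum_of_trace_neg_of_det_pos (A : Matrix (Fin 2) (Fin 2) ℝ)
    (htr : A.trace < 0) (hdet : 0 < A.det) {z : ℂ}
    (hz : z ∈ spectrum ℂ (A.map Complex.ofReal)) : z.re < 0 := by
  rw [Matrix.mem_spectrum_iff_isRoot_charpoly, Polynomial.IsRoot.def, Matrix.eval_charpoly,
    Matrix.det_fin_two] at hz
  rw [Matrix.trace_fin_two] at htr
  rw [Matrix.det_fin_two] at hdet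
  have hre := congrArg Complex.re hz
  have him := congrArg Complex.im hz
  simp at hre him
  by_contra! h
  have him' : z.im * (2 * z.re - (A 0 0 + A 1 1)) = 0 := by linear_combination him
  have hz0 : z.im = 0 := (mul_eq_zero.mp him').resolve_right (by linarith)
  rw [hz0] at hre
  nlinarith [mul_nonneg h (neg_nonneg.mpr htr.le), sq_nonneg z.re]


/-- For every real `a > 1`, at the equilibrium `(x₂, y₂)` the Jacobian
`[[−1, 2y₂ − a], [2x₂ − a, −1]]` has trace `−2` and determinant `(a−1)(a+3) > 0`;
consequently every (complex) eigenvalue has strictly negative real part, so `(x₂, y₂)`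
is linearly stable. -/
theorem offcenter_equilibrium_stable (a : ℝ) (ha : 1 < a)
    (x₂ y₂ : ℝ)
    (hx₂ : x₂ = (a - 1)/2 + (1/2) * Real.sqrt ((a - 1)*(a + 3)))
    (hy₂ : y₂ = (a - 1)/2 - (1/2) * Real.sqrt ((a - 1)*(a + 3))) :
    (!![(-1 : ℝ), 2*y₂ - a; 2*x₂ - a, -1]).trace = -2 ∧
    (!![(-1 : ℝ), 2*y₂ - a; 2*x₂ - a, -1]).det = (a - 1)*(a + 3) ∧
    0 < (a - 1)*(a + 3) ∧
    (∀ z : ℂ, z ∈ spectrum ℂ ((!![(-1 : ℝ), 2*y₂ - a; 2*x₂ - a, -1]).map Complex.ofReal)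
      → z.re < 0) := by
  have hpos : 0 < (a - 1) * (a + 3) := mul_pos (by linarith) (by linarith)
  have htr : (!![(-1 : ℝ), 2*y₂ - a; 2*x₂ - a, -1]).trace = -2 := by
    rw [Matrix.trace_fin_two_of]
    norm_num
  have hdet : (!![(-1 : ℝ), 2*y₂ - a; 2*x₂ - a, -1]).det = (a - 1)*(a + 3) := by
    rw [Matrix.det_fin_two_of, hx₂, hy₂]
    linear_combination Real.sq_sqrt hpos.le
  exact ⟨htr, hdet, hpos, fun z hz =>
    Matrix.re_neg_of_mem_spectrum_of_trace_neg_of_det_pos _ (by rw [htr]; norm_num)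
      (hdet ▸ hpos) hz⟩
end

section
/- Let m be a real number with 0 ≤ m ≤ 2, and let x, y > 0 satisfy 2/(1 + y^m) = x and 2/(1 + x^m) = y (powers taken as real powers). Then (x, y) = (1, 1). In other words, for 0 ≤ m ≤ 2 the only equilibrium of the toggle-switch system dx/dt = 2/(1 + y^m) − x, dy/dt = 2/(1 + x^m) − y with x, y > 0 is (1,1). -/
/-- The toggle switch with cooperativity `0 ≤ m ≤ 2` has no equilibrium with `x > 1`. -/
theorem toggle_equilibrium_le_one {m x y : ℝ}
    (hm₀ : 0 ≤ m) (hm₂ : m ≤ 2) (hy : 0 < y)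
    (h₁ : 2 / (1 + y ^ m) = x) (h₂ : 2 / (1 + x ^ m) = y) : x ≤ 1 := by
  by_contra! hx
  have hym : 0 < y ^ m := Real.rpow_pos_of_pos hy m
  have hxm : 1 ≤ x ^ m := Real.one_le_rpow hx.le hm₀
  have hx_le : x ^ m ≤ x ^ 2 := by
    rw [← Real.rpow_two]
    exact Real.rpow_le_rpow_of_exponent_le hx.le hm₂
  rw [div_eq_iff (by positivity)] at h₁ h₂
  have hy₁ : y < 1 := by
    by_contra! h
    have := Real.one_le_rpow h hm₀
    nlinarith
  have hy_le : y ^ 2 ≤ y ^ m := by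
    rw [← Real.rpow_two]
    exact Real.rpow_le_rpow_of_exponent_ge hy hy₁.le hm₂
  have hA : x * (1 + y ^ 2) ≤ 2 := by nlinarith
  have hB : 2 ≤ y * (1 + x ^ 2) := by nlinarith
  have hA_sq : (x * (1 + y ^ 2)) ^ 2 ≤ 2 ^ 2 := by gcongr
  have hfactor : 0 < (1 - y) ^ 3 * (2 + y + y ^ 2) := by
    have := sub_pos.2 hy₁
    positivity
  have h₃ := mul_le_mul_of_nonneg_right hB (sq_nonneg (1 + y ^ 2))
  have h₄ := mul_le_mul_of_nonneg_left hA_sq hy.le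
  nlinarith

/-- For `0 ≤ m ≤ 2` and `x, y > 0` with `2/(1 + y^m) = x` and `2/(1 + x^m) = y`
(real powers), one has `(x, y) = (1, 1)`: the only positive equilibrium of the toggle
switch with cooperativity `m ≤ 2` is `(1,1)`. -/
theorem toggle_unique_equilibrium (m x y : ℝ)
    (hm₀ : 0 ≤ m) (hm₂ : m ≤ 2) (hx : 0 < x) (hy : 0 < y)
    (h₁ : 2 / (1 + y ^ m) = x) (h₂ : 2 / (1 + x ^ m) = y) :
    x = 1 ∧ y = 1 := by
  have hx₁ := toggle_equilibrium_le_one hm₀ hm₂ hy h₁ h₂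
  have hy₁ := toggle_equilibrium_le_one hm₀ hm₂ hx h₂ h₁
  have hxm : x ^ m ≤ 1 := Real.rpow_le_one hx.le hx₁ hm₀
  have hym : y ^ m ≤ 1 := Real.rpow_le_one hy.le hy₁ hm₀
  rw [div_eq_iff (by positivity)] at h₁ h₂
  constructor <;> nlinarith
end
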